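/- For each i ≥ 1 let u_i : [0,∞) → C_0((0,1)) be continuous and let t_i > 0 satisfy Σ_{i≥1} t_i = ∞. Define the concatenation g : [0,∞) → C_0((0,1)) by g(t) := u_j(t − S_{j−1}) for S_{j−1} ≤ t < S_j. For each n let u_i^n : [0,∞) → C_0((0,1)) and t_i^n ≥ 0 be such that, for every i, u_i^n → u_i uniformly (in ‖·‖_∞) on compact subsets of [0,∞) and t_i^n → t_i; let S_j^n and the concatenation g_n be defined analogously. Then for every T > 0 with T ≠ S_j for all j ≥ 1, for all sufficiently large n there exist continuous strictly increasing bijections λ_n : [0,T] → [0,T] such that sup_{t∈[0,T]} |λ_n(t) − t| → 0 and sup_{t∈[0,T]} ‖g_n(λ_n(t)) − g(t)‖_∞ → 0 as n → ∞. -/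

import Mathlib

open Filter

/-- Partial sums `S_j = t_0 + ⋯ + t_{j-1}` of a sequence of reals. -/
def pSum (t : ℕ → ℝ) (j : ℕ) : ℝ := ∑ i ∈ Finset.range j, t i

/-- The concatenation `g((u_i), (t_i))(s) = Σ_j u_j(s − S_j)·1{S_j ≤ s < S_{j+1}}`
of the paths `u_j` along the durations `t_j`. -/
noncomputable def concat {E : Type*} [AddCommMonoid E] [TopologicalSpace E]
    (u : ℕ → ℝ → E) (t : ℕ → ℝ) (s : ℝ) : E :=
  ∑' j : ℕ, if pSum t j ≤ s ∧ s < pSum t (j + 1) then u j (s - pSum t j) else 0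

lemma pSum_succ' (t : ℕ → ℝ) (j : ℕ) : pSum t (j+1) = pSum t j + t j := by
  simp [pSum, Finset.sum_range_succ]

lemma pSum_zero' (t : ℕ → ℝ) : pSum t 0 = 0 := by simp [pSum]

lemma pSum_mono' (t : ℕ → ℝ) (ht : ∀ i, 0 ≤ t i) : Monotone (pSum t) := by
  apply monotone_nat_of_le_succ
  intro n
  rw [pSum_succ']
  linarith [ht n]

lemma concat_eval {E : Type*} [AddCommMonoid E] [TopologicalSpace E]
    (u : ℕ → ℝ → E) (t : ℕ → ℝ) (ht : ∀ i, 0 ≤ t i) (s : ℝ) (j : ℕ)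
    (h1 : pSum t j ≤ s) (h2 : s < pSum t (j+1)) : concat u t s = u j (s - pSum t j) := by
  unfold concat
  rw [tsum_eq_single j]
  · simp [h1, h2]
  · intro i hi
    rw [if_neg]
    rintro ⟨h3, h4⟩
    rcases lt_or_gt_of_ne hi with h | h
    · have := pSum_mono' t ht (show i + 1 ≤ j from h)
      linarith
    · have := pSum_mono' t ht (show j + 1 ≤ i from h)
      linarith

lemma exists_index (t : ℕ → ℝ) (s : ℝ) (hs : 0 ≤ s) (k : ℕ) (h : s < pSum t (k+1)) :
    ∃ j ≤ k, pSum t j ≤ s ∧ s < pSum t (j+1) := by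
  induction k with
  | zero => exact ⟨0, le_rfl, by simpa [pSum_zero'] using hs, h⟩
  | succ k ih =>
    by_cases hk : s < pSum t (k+1)
    · obtain ⟨j, hj, h1⟩ := ih hk
      exact ⟨j, by omega, h1⟩
    · exact ⟨k+1, le_rfl, not_lt.mp hk, h⟩

/-- ramp -/
noncomputable def ramp (a : ℕ → ℝ) (i : ℕ) (s : ℝ) : ℝ := max 0 (min (s - pSum a i) (a i))

/-- time change -/
noncomputable def tchange (K : ℕ) (a b : ℕ → ℝ) (s : ℝ) : ℝ :=
  ∑ i ∈ Finset.range K, b i / a i * ramp a i s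

lemma ramp_mono (a : ℕ → ℝ) (i : ℕ) : Monotone (ramp a i) := by
  intro x y h
  unfold ramp
  gcongr

lemma sum_ramp (a : ℕ → ℝ) (ha : ∀ i, 0 < a i) (K : ℕ) (s : ℝ) :
    ∑ i ∈ Finset.range K, ramp a i s = max 0 (min s (pSum a K)) := by
  induction K with
  | zero => simp [pSum_zero']
  | succ K ih =>
    rw [Finset.sum_range_succ, ih, pSum_succ', ramp]
    have h1 := ha K
    have h2 := pSum_mono' a (fun i => (ha i).le) (Nat.zero_le K)
    rw [pSum_zero'] at h2
    simp only [max_def, min_def]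
    split_ifs <;> linarith

lemma tchange_cont (K : ℕ) (a b : ℕ → ℝ) : Continuous (tchange K a b) := by
  unfold tchange ramp
  fun_prop

lemma tchange_strictMono (K : ℕ) (a b : ℕ → ℝ) (ha : ∀ i, 0 < a i)
    (hb : ∀ i < K, a i / 2 ≤ b i) : StrictMonoOn (tchange K a b) (Set.Icc 0 (pSum a K)) := by
  intro x hx y hy hxy
  have e : ∀ s ∈ Set.Icc 0 (pSum a K), tchange K a b s
      = ∑ i ∈ Finset.range K, (b i / a i - 1/2) * ramp a i s + s / 2 := by
    intro s hs
    have := sum_ramp a ha K s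
    rw [min_eq_left hs.2, max_eq_right hs.1] at this
    simp only [sub_mul, Finset.sum_sub_distrib, ← Finset.mul_sum, this, tchange]
    ring
  rw [e x hx, e y hy]
  have : ∑ i ∈ Finset.range K, (b i / a i - 1/2) * ramp a i x
      ≤ ∑ i ∈ Finset.range K, (b i / a i - 1/2) * ramp a i y := by
    apply Finset.sum_le_sum
    intro i hi
    apply mul_le_mul_of_nonneg_left (ramp_mono a i hxy.le)
    rw [sub_nonneg, le_div_iff₀ (ha i)]
    linarith [hb i (Finset.mem_range.mp hi)]
  linarith

lemma tchange_pSum (K : ℕ) (a b : ℕ → ℝ) (ha : ∀ i, 0 < a i) (j : ℕ) (hj : j ≤ K) :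
    tchange K a b (pSum a j) = pSum b j := by
  unfold tchange
  rw [← Finset.sum_range_add_sum_Ico _ hj]
  rw [Finset.sum_eq_zero (s := Finset.Ico j K), add_zero]
  · unfold pSum
    apply Finset.sum_congr rfl
    intro i hi
    have h := pSum_mono' a (fun i => (ha i).le) (show i + 1 ≤ j from Finset.mem_range.mp hi)
    rw [pSum_succ'] at h
    change b i / a i * max 0 (min (pSum a j - pSum a i) (a i)) = _
    rw [min_eq_right (by linarith), max_eq_right (ha i).le]
    field_simp [(ha i).ne']
  · intro i hi
    have h := pSum_mono' a (fun i => (ha i).le) (Finset.mem_Ico.mp hi).1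
    unfold ramp
    rw [max_eq_left, mul_zero]
    exact (min_le_left _ _).trans (by linarith)

lemma tchange_dist (K : ℕ) (a b : ℕ → ℝ) (ha : ∀ i, 0 < a i) (s : ℝ)
    (hs : s ∈ Set.Icc 0 (pSum a K)) :
    |tchange K a b s - s| ≤ ∑ i ∈ Finset.range K, |b i - a i| := by
  have := sum_ramp a ha K s
  rw [min_eq_left hs.2, max_eq_right hs.1] at this
  have e : tchange K a b s - s = ∑ i ∈ Finset.range K, (b i / a i * ramp a i s - ramp a i s) := by
    rw [Finset.sum_sub_distrib, this, tchange]
  rw [e]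
  refine (Finset.abs_sum_le_sum_abs _ _).trans (Finset.sum_le_sum fun i _ => ?_)
  have h0 := ha i
  have h1 : 0 ≤ ramp a i s := le_max_left _ _
  have h2 : ramp a i s ≤ a i := max_le h0.le (min_le_right _ _)
  have : b i / a i * ramp a i s - ramp a i s = (b i - a i) * (ramp a i s / a i) := by
    field_simp
  rw [this, abs_mul, abs_of_nonneg (div_nonneg h1 h0.le)]
  exact mul_le_of_le_one_right (abs_nonneg _) ((div_le_one h0).mpr h2)

/-- Continuity of the concatenation map for paths with values
in `C_0((0,1))` (modelled as `C([0,1],ℝ)` with the sup norm), in the Skorokhod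
J1 sense: if `uᵢⁿ → uᵢ` uniformly (in `‖·‖_∞`) on compacts with each `uᵢ`
continuous, and `tᵢⁿ → tᵢ` with `tᵢ > 0` and `Σᵢ tᵢ = ∞`, then for each
`T > 0` that is not a partial sum of the `tᵢ`, there are (for large `n`)
continuous strictly increasing bijections `λₙ : [0,T] → [0,T]` with
`sup_{[0,T]} |λₙ(s) − s| → 0` and `sup_{[0,T]} ‖gₙ(λₙ(s)) − g(s)‖_∞ → 0`. -/
theorem stmt7
    (u : ℕ → ℝ → C(Set.Icc (0:ℝ) 1, ℝ)) (hu : ∀ i, Continuous (u i))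
    (t : ℕ → ℝ) (ht : ∀ i, 0 < t i)
    (htsum : Tendsto (fun j => pSum t j) atTop atTop)
    (un : ℕ → ℕ → ℝ → C(Set.Icc (0:ℝ) 1, ℝ)) (tn : ℕ → ℕ → ℝ)
    (htn_nonneg : ∀ n i, 0 ≤ tn n i)
    (hun : ∀ (i : ℕ) (T : ℝ), 0 < T →
      TendstoUniformlyOn (fun n s => un n i s) (u i) atTop (Set.Icc 0 T))
    (htn : ∀ i, Tendsto (fun n => tn n i) atTop (nhds (t i))) :
    ∀ T : ℝ, 0 < T → (∀ j : ℕ, 1 ≤ j → pSum t j ≠ T) →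
      ∃ lam : ℕ → ℝ → ℝ,
        (∀ᶠ n in atTop,
          ContinuousOn (lam n) (Set.Icc 0 T) ∧
          StrictMonoOn (lam n) (Set.Icc 0 T) ∧
          Set.BijOn (lam n) (Set.Icc 0 T) (Set.Icc 0 T)) ∧
        TendstoUniformlyOn (fun n s => lam n s) (fun s => s) atTop (Set.Icc 0 T) ∧
        TendstoUniformlyOn (fun n s => concat (un n) (tn n) (lam n s))
          (fun s => concat u t s) atTop (Set.Icc 0 T) := by
  intro T hT hTj
  obtain ⟨k, hk1, hk2⟩ : ∃ k, pSum t k < T ∧ T < pSum t (k+1) := by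
    obtain ⟨N, hN⟩ := (htsum.eventually (eventually_gt_atTop T)).exists
    have hN' : T < pSum t (N+1) :=
      hN.trans_le (pSum_mono' t (fun i => (ht i).le) (Nat.le_succ N))
    obtain ⟨j, _, h1, h2⟩ := exists_index t T hT.le N hN'
    refine ⟨j, lt_of_le_of_ne h1 ?_, h2⟩
    rcases Nat.eq_zero_or_pos j with h | h
    · rw [h, pSum_zero']
      exact hT.ne
    · exact hTj j h
  have hpS : ∀ j, Tendsto (fun n => pSum (tn n) j) atTop (nhds (pSum t j)) := by
    intro j
    exact tendsto_finsetSum _ fun i _ => htn i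
  let a : ℕ → ℝ := fun i => if i = k then T - pSum t k else t i
  let b : ℕ → ℕ → ℝ := fun n i => if i = k then T - pSum (tn n) k else tn n i
  have ha : ∀ i, 0 < a i := by
    intro i
    by_cases h : i = k
    · simp only [a, if_pos h]
      linarith
    · simp only [a, if_neg h]
      exact ht i
  have hb : ∀ i, Tendsto (fun n => b n i) atTop (nhds (a i)) := by
    intro i
    by_cases h : i = k
    · simp only [a, b, if_pos h]
      exact tendsto_const_nhds.sub (hpS k)
    · simp only [a, b, if_neg h]
      exact htn i
  have hpa : ∀ j ≤ k, pSum a j = pSum t j := by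
    intro j hj
    apply Finset.sum_congr rfl
    intro i hi
    have : i ≠ k := by have := Finset.mem_range.mp hi; omega
    simp [a, this]
  have hpb : ∀ n, ∀ j ≤ k, pSum (b n) j = pSum (tn n) j := by
    intro n j hj
    apply Finset.sum_congr rfl
    intro i hi
    have : i ≠ k := by have := Finset.mem_range.mp hi; omega
    simp [b, this]
  have hpaT : pSum a (k+1) = T := by
    rw [pSum_succ', hpa k le_rfl]
    simp [a]
  have hpbT : ∀ n, pSum (b n) (k+1) = T := by
    intro n
    rw [pSum_succ', hpb n k le_rfl]
    simp [b]
  have hgood : ∀ᶠ n in atTop, ∀ i < k+1, a i / 2 ≤ b n i := by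
    refine (eventually_all_finite (Set.finite_lt_nat (k+1))).mpr fun i _ => ?_
    exact ((hb i).eventually (lt_mem_nhds (half_lt_self (ha i)))).mono fun n hn => hn.le
  have hsm : ∀ n, (∀ i < k+1, a i / 2 ≤ b n i) →
      StrictMonoOn (tchange (k+1) a (b n)) (Set.Icc 0 T) := by
    intro n hn
    have := tchange_strictMono (k+1) a (b n) ha hn
    rwa [hpaT] at this
  have hl0 : ∀ n, tchange (k+1) a (b n) 0 = 0 := by
    intro n
    simpa [pSum_zero'] using tchange_pSum (k+1) a (b n) ha 0 (Nat.zero_le _)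
  have hlT : ∀ n, tchange (k+1) a (b n) T = T := by
    intro n
    have := tchange_pSum (k+1) a (b n) ha (k+1) le_rfl
    rwa [hpaT, hpbT] at this
  have hlj : ∀ n, ∀ j ≤ k, tchange (k+1) a (b n) (pSum t j) = pSum (tn n) j := by
    intro n j hj
    have := tchange_pSum (k+1) a (b n) ha j (by omega)
    rwa [hpa j hj, hpb n j hj] at this
  have hD : Tendsto (fun n => ∑ i ∈ Finset.range (k+1), |b n i - a i|) atTop (nhds 0) := by
    have : Tendsto (fun n => ∑ i ∈ Finset.range (k+1), |b n i - a i|) atTop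
        (nhds (∑ i ∈ Finset.range (k+1), |a i - a i|)) :=
      tendsto_finsetSum _ fun i _ => ((hb i).sub tendsto_const_nhds).abs
    simpa using this
  have hld : ∀ n, ∀ s ∈ Set.Icc 0 T, |tchange (k+1) a (b n) s - s| ≤
      ∑ i ∈ Finset.range (k+1), |b n i - a i| := by
    intro n s hs
    exact tchange_dist (k+1) a (b n) ha s (by rwa [hpaT])
  have hun' : TendstoUniformlyOn (fun n s => tchange (k+1) a (b n) s) (fun s => s) atTop
      (Set.Icc 0 T) := by
    rw [Metric.tendstoUniformlyOn_iff]
    intro ε hε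
    filter_upwards [hD.eventually (gt_mem_nhds hε)] with n hn s hs
    rw [dist_comm, Real.dist_eq]
    exact (hld n s hs).trans_lt hn
  refine ⟨fun n => tchange (k+1) a (b n), ?_, hun', ?_⟩
  · filter_upwards [hgood] with n hn
    have hs := hsm n hn
    have hc := (tchange_cont (k+1) a (b n)).continuousOn (s := Set.Icc 0 T)
    refine ⟨hc, hs, ?_, hs.injOn, ?_⟩
    · intro s hsT
      constructor
      · rw [← hl0 n]
        exact hs.monotoneOn ⟨le_rfl, hT.le⟩ hsT hsT.1
      · rw [← hlT n]
        exact hs.monotoneOn hsT ⟨hT.le, le_rfl⟩ hsT.2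
    · have := intermediate_value_Icc hT.le hc
      rwa [hl0, hlT] at this
  · rw [Metric.tendstoUniformlyOn_iff]
    intro ε hε
    have key : ∀ j ≤ k, ∀ᶠ n in atTop, ∀ s ∈ Set.Icc 0 T, pSum t j ≤ s → s < pSum t (j+1) →
        dist (concat u t s) (concat (un n) (tn n) (tchange (k+1) a (b n) s)) < ε := by
      intro j hj
      have huc : UniformContinuousOn (u j) (Set.Icc 0 T) :=
        isCompact_Icc.uniformContinuousOn_of_continuous (hu j).continuousOn
      obtain ⟨δ, hδ, huc⟩ := Metric.uniformContinuousOn_iff.mp huc (ε/2) (half_pos hε)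
      have h1 := Metric.tendstoUniformlyOn_iff.mp (hun j T hT) (ε/2) (half_pos hε)
      filter_upwards [hgood, h1, hD.eventually (gt_mem_nhds (half_pos hδ)),
        Metric.tendsto_nhds.mp (hpS j) (δ/2) (half_pos hδ),
        (hpS (k+1)).eventually (lt_mem_nhds hk2)] with n hn h1 h2 h3 h4 s hs hs1 hs2
      have hsmn := hsm n hn
      have hj0 : 0 ≤ pSum t j := by
        have := pSum_mono' t (fun i => (ht i).le) (Nat.zero_le j)
        rwa [pSum_zero'] at this
      have hj0n : 0 ≤ pSum (tn n) j := by
        have := pSum_mono' (tn n) (htn_nonneg n) (Nat.zero_le j)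
        rwa [pSum_zero'] at this
      have hlow : pSum (tn n) j ≤ tchange (k+1) a (b n) s := by
        rw [← hlj n j hj]
        exact hsmn.monotoneOn ⟨hj0, hs1.trans hs.2⟩ hs hs1
      have hupT : tchange (k+1) a (b n) s ≤ T := by
        conv_rhs => rw [← hlT n]
        exact hsmn.monotoneOn hs ⟨hT.le, le_rfl⟩ hs.2
      have hup : tchange (k+1) a (b n) s < pSum (tn n) (j+1) := by
        rcases Nat.lt_or_ge j k with h | h
        · rw [← hlj n (j+1) h]
          have := pSum_mono' t (fun i => (ht i).le) (show j + 1 ≤ k from h)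
          exact hsmn hs ⟨hs.1.trans hs2.le, this.trans hk1.le⟩ hs2
        · obtain rfl : j = k := le_antisymm hj h
          exact hupT.trans_lt h4
      rw [concat_eval u t (fun i => (ht i).le) s j hs1 hs2,
        concat_eval (un n) (tn n) (htn_nonneg n) _ j hlow hup]
      have hx : s - pSum t j ∈ Set.Icc 0 T := ⟨by linarith, by linarith [hs.2]⟩
      have hx' : tchange (k+1) a (b n) s - pSum (tn n) j ∈ Set.Icc 0 T :=
        ⟨by linarith, by linarith⟩
      have hA := h1 _ hx'
      have hB : dist (s - pSum t j) (tchange (k+1) a (b n) s - pSum (tn n) j) < δ := by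
        have h5 := (hld n s hs).trans_lt h2
        rw [Real.dist_eq] at h3 ⊢
        rw [abs_lt] at h3 h5 ⊢
        constructor <;> linarith [h3.1, h3.2, h5.1, h5.2]
      have hC := huc _ hx _ hx' hB
      linarith [dist_triangle (u j (s - pSum t j))
        (u j (tchange (k+1) a (b n) s - pSum (tn n) j))
        (un n j (tchange (k+1) a (b n) s - pSum (tn n) j))]
    have key' := (eventually_all_finite (Set.finite_le_nat k)).mpr key
    filter_upwards [key'] with n hn s hs
    obtain ⟨j, hj, h1, h2⟩ := exists_index t s hs.1 k (hs.2.trans_lt hk2)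
    exact hn j hj s hs h1 h2
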